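/- arXiv:2007.01036 — 2 statements merged into one kernel-verified Lean document; each statement's English description precedes it below -/
import Mathlib

section
/- For u ∈ Ω, the entropy potential in the x-direction satisfies ψ(u) := v(u) · f(u) - F(u) = 2ρ v^x, where v(u) = ∇_u U(u) is the entropy variable, f is the x-direction ten-moment flux, and F(u) = -ρ v^x ln(det p/ρ⁴). -/
/-!
Ten-moment Gaussian closure equations: basic definitions.
Conservative state `u = (ρ, mˣ, mʸ, Eˣˣ, Eˣʸ, Eʸʸ) ∈ ℝ⁶`.
-/

noncomputable section

namespace TenMoment

/-- The space of conservative variables: vectors in `ℝ⁶`. -/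
abbrev St : Type := Fin 6 → ℝ

/-- Density `ρ`. -/
def rho (u : St) : ℝ := u 0
/-- Velocity `vˣ = mˣ/ρ`. -/
def vx (u : St) : ℝ := u 1 / u 0
/-- Velocity `vʸ = mʸ/ρ`. -/
def vy (u : St) : ℝ := u 2 / u 0
/-- Pressure component `pˣˣ = Eˣˣ - ρ vˣ vˣ`. -/
def pxx (u : St) : ℝ := u 3 - rho u * vx u * vx u
/-- Pressure component `pˣʸ = Eˣʸ - ρ vˣ vʸ`. -/
def pxy (u : St) : ℝ := u 4 - rho u * vx u * vy u
/-- Pressure component `pʸʸ = Eʸʸ - ρ vʸ vʸ`. -/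
def pyy (u : St) : ℝ := u 5 - rho u * vy u * vy u
/-- The symmetric 2×2 pressure tensor. -/
def pmat (u : St) : Matrix (Fin 2) (Fin 2) ℝ := !![pxx u, pxy u; pxy u, pyy u]
/-- `det p`. -/
def detp (u : St) : ℝ := pxx u * pyy u - pxy u * pxy u

/-- The admissible set `Ω`: positive density and positive definite pressure tensor. -/
def admissible (u : St) : Prop := 0 < rho u ∧ (pmat u).PosDef

/-- Entropy `U(u) = -ρ ln (det p / ρ⁴)`. -/
def entU (u : St) : ℝ := - rho u * Real.log (detp u / (rho u) ^ 4)
/-- Entropy flux (x-direction) `F(u) = -ρ vˣ ln (det p / ρ⁴)`. -/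
def entF (u : St) : ℝ := - rho u * vx u * Real.log (detp u / (rho u) ^ 4)
/-- Entropy flux (y-direction) `G(u) = -ρ vʸ ln (det p / ρ⁴)`. -/
def entG (u : St) : ℝ := - rho u * vy u * Real.log (detp u / (rho u) ^ 4)

/-- The x-direction flux of the ten-moment system. -/
def fluxF (u : St) : St :=
  ![rho u * vx u,
    rho u * vx u ^ 2 + pxx u,
    rho u * vx u * vy u + pxy u,
    rho u * vx u ^ 3 + 3 * vx u * pxx u,
    rho u * vx u ^ 2 * vy u + 2 * vx u * pxy u + vy u * pxx u,
    rho u * vx u * vy u ^ 2 + vx u * pyy u + 2 * vy u * pxy u]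

/-- The y-direction flux of the ten-moment system. -/
def fluxG (u : St) : St :=
  ![rho u * vy u,
    rho u * vx u * vy u + pxy u,
    rho u * vy u ^ 2 + pyy u,
    rho u * vy u * vx u ^ 2 + vy u * pxx u + 2 * vx u * pxy u,
    rho u * vy u ^ 2 * vx u + 2 * vy u * pxy u + vx u * pyy u,
    rho u * vy u ^ 3 + 3 * vy u * pyy u]

/-- The gradient of the entropy `U` with respect to the conservative variables
(the entropy variable `v(u) = ∇ᵤ U(u)`). -/
def gradU (u : St) : St := fun i => fderiv ℝ entU u (Pi.single i 1)

/-- Euclidean dot product on `ℝ⁶`. -/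
def dot (a b : St) : ℝ := ∑ i, a i * b i

/-- The x-direction source term, for a pointwise value `Wx` of `∂ₓW`. -/
def srcX (Wx : ℝ) (u : St) : St :=
  ![0, -(1/2) * rho u * Wx, 0, -(rho u * vx u * Wx), -(1/2) * rho u * vy u * Wx, 0]

/-- The y-direction source term, for a pointwise value `Wy` of `∂_y W`. -/
def srcY (Wy : ℝ) (u : St) : St :=
  ![0, 0, -(1/2) * rho u * Wy, 0, -(1/2) * rho u * vx u * Wy, -(rho u * vy u * Wy)]

/-- The x-direction entropy potential `ψ(u) = v(u)·f(u) - F(u)`. -/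
def psiX (u : St) : ℝ := dot (gradU u) (fluxF u) - entF u

/-- The Jacobian `Df(u)` of the x-direction flux with respect to the conservative variables. -/
def jacF (u : St) : Matrix (Fin 6) (Fin 6) ℝ :=
  fun i j => fderiv ℝ (fun w => fluxF w i) u (Pi.single j 1)

/-- The boundary coefficients `τ₀ = -1`, `τ_k = 1`, `τ_j = 0` otherwise. -/
def tau (k : ℕ) : Fin (k+1) → ℝ :=
  fun j => if (j : ℕ) = 0 then -1 else if (j : ℕ) = k then 1 else 0

/-- The logarithmic mean: `(b-a)/(ln b - ln a)` for `a ≠ b`, and `a` when `a = b`. -/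
def logMean (a b : ℝ) : ℝ := if a = b then a else (b - a) / (Real.log b - Real.log a)

/-- The arithmetic mean. -/
def avg (a b : ℝ) : ℝ := (a + b) / 2

/-- Auxiliary variable `D = det p / ρ`. -/
def Dq (u : St) : ℝ := detp u / rho u
/-- `β_{xx} = pˣˣ/D`. -/
def bxx (u : St) : ℝ := pxx u / Dq u
/-- `β_{xy} = pˣʸ/D`. -/
def bxy (u : St) : ℝ := pxy u / Dq u
/-- `β_{yy} = pʸʸ/D`. -/
def byy (u : St) : ℝ := pyy u / Dq u
/-- `D_β = β_{xx} β_{yy} - β_{xy}²`. -/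
def Db (u : St) : ℝ := bxx u * byy u - bxy u ^ 2

/-- The entropy conservative two-point flux of Sen–Kumar for the x-direction. -/
def fstarEC (uL uR : St) : St :=
  let rln := logMean (rho uL) (rho uR)
  let vxb := avg (vx uL) (vx uR)
  let vyb := avg (vy uL) (vy uR)
  let rb := avg (rho uL) (rho uR)
  let bxxb := avg (bxx uL) (bxx uR)
  let bxyb := avg (bxy uL) (bxy uR)
  let byyb := avg (byy uL) (byy uR)
  let Dbln := logMean (Db uL) (Db uR)
  let vx2b := avg (vx uL ^ 2) (vx uR ^ 2)
  let vy2b := avg (vy uL ^ 2) (vy uR ^ 2)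
  let vxyb := avg (vx uL * vy uL) (vx uR * vy uR)
  let f1 := rln * vxb
  let f2 := f1 * vxb + rb * bxxb / (bxxb * byyb - bxyb ^ 2)
  let f3 := f1 * vyb + rb * bxyb / (bxxb * byyb - bxyb ^ 2)
  ![f1, f2, f3,
    (bxxb / Dbln - vx2b) * f1 + 2 * vxb * f2,
    (bxyb / Dbln - vxyb) * f1 + vxb * f3 + vyb * f2,
    (byyb / Dbln - vy2b) * f1 + 2 * vyb * f3]

end TenMoment

namespace TenMoment

theorem detp_pos_of_admissible (u : St) (hu : admissible u) : 0 < detp u := by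
  have h := hu.2.det_pos
  simpa [pmat, detp, Matrix.det_fin_two] using h

theorem entU_differentiableAt (u : St) (hu : admissible u) : DifferentiableAt ℝ entU u := by
  have hr : u 0 ≠ 0 := hu.1.ne'
  have hd := (detp_pos_of_admissible u hu).ne'
  have h1 : DifferentiableAt ℝ detp u := by
    unfold detp pxx pxy pyy rho vx vy
    fun_prop (disch := assumption)
  have h2 : DifferentiableAt ℝ rho u := by
    unfold rho
    fun_prop
  unfold entU
  have h3 : rho u ^ 4 ≠ 0 := pow_ne_zero _ hr
  have h5 : DifferentiableAt ℝ (fun u => detp u / rho u ^ 4) u := by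
    fun_prop (disch := assumption)
  exact h2.neg.mul (h5.log (div_ne_zero hd h3))

/-- The directional derivative as a dot product with the gradient. -/
theorem dot_gradU (u w : St) : dot (gradU u) w = fderiv ℝ entU u w := by
  conv_rhs => rw [pi_eq_sum_univ' w, map_sum]
  unfold dot gradU
  refine Finset.sum_congr rfl fun i _ => ?_
  rw [map_smul, smul_eq_mul, mul_comm]

/-- Derivative of the entropy along the flux direction. -/
theorem fderiv_entU_fluxF (u : St) (hu : admissible u) :
    fderiv ℝ entU u (fluxF u) =
      - (rho u * vx u) * Real.log (detp u / rho u ^ 4) + 2 * rho u * vx u := by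
  have hr : rho u ≠ 0 := hu.1.ne'
  have hd := (detp_pos_of_admissible u hu).ne'
  set c : ℝ → St := fun t => u + t • fluxF u with hc
  have c0 : c 0 = u := by simp [hc]
  have hcd : HasDerivAt c (fluxF u) 0 := by
    have h := ((hasDerivAt_id (0 : ℝ)).smul_const (fluxF u)).const_add u
    rw [one_smul] at h
    exact h
  have hci : ∀ i, HasDerivAt (fun t => c t i) (fluxF u i) 0 := hasDerivAt_pi.1 hcd
  have m1 : u 1 = rho u * vx u := by unfold vx rho at *; field_simp
  have m2 : u 2 = rho u * vy u := by unfold vy rho at *; field_simp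
  have hrho : HasDerivAt (fun t => rho (c t)) (rho u * vx u) 0 := hci 0
  have hr0 : c 0 0 ≠ 0 := by rw [c0]; exact hr
  have hvx : HasDerivAt (fun t => vx (c t)) (pxx u / rho u) 0 := by
    refine ((hci 1).div (hci 0) hr0).congr_deriv ?_
    rw [c0, m1]
    change ((rho u * vx u ^ 2 + pxx u) * rho u - rho u * vx u * (rho u * vx u)) / rho u ^ 2 = _
    field_simp
    ring
  have hvy : HasDerivAt (fun t => vy (c t)) (pxy u / rho u) 0 := by
    refine ((hci 2).div (hci 0) hr0).congr_deriv ?_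
    rw [c0, m2]
    change ((rho u * vx u * vy u + pxy u) * rho u - rho u * vy u * (rho u * vx u)) / rho u ^ 2 = _
    field_simp
    ring
  have hpxx : HasDerivAt (fun t => pxx (c t)) (vx u * pxx u) 0 := by
    refine ((hci 3).sub ((hrho.mul hvx).mul hvx)).congr_deriv ?_
    simp only [Pi.mul_apply, c0]
    change (rho u * vx u ^ 3 + 3 * vx u * pxx u) - _ = _
    field_simp
    ring
  have hpxy : HasDerivAt (fun t => pxy (c t)) (vx u * pxy u) 0 := by
    refine ((hci 4).sub ((hrho.mul hvx).mul hvy)).congr_deriv ?_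
    simp only [Pi.mul_apply, c0]
    change (rho u * vx u ^ 2 * vy u + 2 * vx u * pxy u + vy u * pxx u) - _ = _
    field_simp
    ring
  have hpyy : HasDerivAt (fun t => pyy (c t)) (vx u * pyy u) 0 := by
    refine ((hci 5).sub ((hrho.mul hvy).mul hvy)).congr_deriv ?_
    simp only [Pi.mul_apply, c0]
    change (rho u * vx u * vy u ^ 2 + vx u * pyy u + 2 * vy u * pxy u) - _ = _
    field_simp
    ring
  have hdet : HasDerivAt (fun t => detp (c t)) (2 * vx u * detp u) 0 := by
    refine ((hpxx.mul hpyy).sub (hpxy.mul hpxy)).congr_deriv ?_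
    simp only [c0]
    unfold detp
    ring
  have h4 : rho (c 0) ^ 4 ≠ 0 := by rw [c0]; exact pow_ne_zero _ hr
  have hlog : HasDerivAt (fun t => Real.log (detp (c t) / rho (c t) ^ 4)) (-2 * vx u) 0 := by
    have hq := hdet.div (hrho.pow 4) h4
    refine (hq.log (div_ne_zero (by simpa only [c0] using hd) h4)).congr_deriv ?_
    simp only [Pi.div_apply, Pi.pow_apply, c0]
    field_simp
    ring
  have hU : HasDerivAt (fun t => entU (c t)) 
      (- (rho u * vx u) * Real.log (detp u / rho u ^ 4) + 2 * rho u * vx u) 0 := by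
    refine (hrho.neg.mul hlog).congr_deriv ?_
    simp only [Pi.neg_apply, c0]
    ring
  have hdiff : HasFDerivAt entU (fderiv ℝ entU u) (c 0) := by
    rw [c0]; exact (entU_differentiableAt u hu).hasFDerivAt
  exact (hdiff.comp_hasDerivAt (0 : ℝ) hcd).unique hU

end TenMoment

open TenMoment in
/-- For `u ∈ Ω`, the x-direction entropy potential satisfies
`ψ(u) = v(u)·f(u) - F(u) = 2 ρ vˣ`. -/
theorem tenMoment_entropy_potential_x (u : St) (hu : admissible u) :
    dot (gradU u) (fluxF u) - entF u = 2 * rho u * vx u := by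
  rw [dot_gradU, fderiv_entU_fluxF u hu]
  unfold entF
  ring
end
end

section
/- For every admissible ten-moment state u ∈ Ω, the 6×6 Jacobian Df(u) of the x-direction ten-moment flux is diagonalizable over ℝ (i.e., the one-dimensional ten-moment Gaussian closure system is hyperbolic on Ω). -/
/-!
Ten-moment Gaussian closure equations: basic definitions.
Conservative state `u = (ρ, mˣ, mʸ, Eˣˣ, Eˣʸ, Eʸʸ) ∈ ℝ⁶`.
-/

noncomputable section

namespace TenMoment

lemma hasF_vx (u : St) (h : u 0 ≠ 0) : DifferentiableAt ℝ vx u ∧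
    ∀ e, fderiv ℝ vx u e = (e 1 - vx u * e 0) / u 0 := by
  have h0 : HasFDerivAt (fun w : St => w 0) _ u := hasFDerivAt_apply (𝕜 := ℝ) 0 u
  have h1 : HasFDerivAt (fun w : St => w 1) _ u := hasFDerivAt_apply (𝕜 := ℝ) 1 u
  have h2 := h1.fun_mul ((hasDerivAt_inv h).comp_hasFDerivAt u h0)
  have h3 : HasFDerivAt vx _ u := h2
  refine ⟨h3.differentiableAt, fun e => ?_⟩
  rw [h3.fderiv]
  simp [vx]
  field_simp
  ring

lemma hasF_vy (u : St) (h : u 0 ≠ 0) : DifferentiableAt ℝ vy u ∧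
    ∀ e, fderiv ℝ vy u e = (e 2 - vy u * e 0) / u 0 := by
  have h0 : HasFDerivAt (fun w : St => w 0) _ u := hasFDerivAt_apply (𝕜 := ℝ) 0 u
  have h1 : HasFDerivAt (fun w : St => w 2) _ u := hasFDerivAt_apply (𝕜 := ℝ) 2 u
  have h2 := h1.fun_mul ((hasDerivAt_inv h).comp_hasFDerivAt u h0)
  have h3 : HasFDerivAt vy _ u := h2
  refine ⟨h3.differentiableAt, fun e => ?_⟩
  rw [h3.fderiv]
  simp [vy]
  field_simp
  ring

/-- Explicit directional derivative of the flux. -/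
def dflux (u e : St) : St :=
  ![e 1, e 3, e 4,
    3 * ((e 1 - vx u * e 0) / u 0 * u 3 + vx u * e 3)
      - 2 * (e 0 * vx u ^ 3 + 3 * u 0 * vx u ^ 2 * ((e 1 - vx u * e 0) / u 0)),
    2 * ((e 1 - vx u * e 0) / u 0 * u 4 + vx u * e 4)
      + ((e 2 - vy u * e 0) / u 0 * u 3 + vy u * e 3)
      - 2 * (e 0 * vx u ^ 2 * vy u + 2 * u 0 * vx u * vy u * ((e 1 - vx u * e 0) / u 0)
        + u 0 * vx u ^ 2 * ((e 2 - vy u * e 0) / u 0)),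
    ((e 1 - vx u * e 0) / u 0 * u 5 + vx u * e 5)
      + 2 * ((e 2 - vy u * e 0) / u 0 * u 4 + vy u * e 4)
      - 2 * (e 0 * vx u * vy u ^ 2 + u 0 * vy u ^ 2 * ((e 1 - vx u * e 0) / u 0)
        + 2 * u 0 * vx u * vy u * ((e 2 - vy u * e 0) / u 0))]

lemma fderiv_flux (u : St) (h : u 0 ≠ 0) (e : St) (i : Fin 6) :
    fderiv ℝ (fun w => fluxF w i) u e = dflux u e i := by
  obtain ⟨dx, ex⟩ := hasF_vx u h
  obtain ⟨dy, ey⟩ := hasF_vy u h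
  have hx := dx.hasFDerivAt
  have hy := dy.hasFDerivAt
  have c : ∀ j : Fin 6, HasFDerivAt (fun w : St => w j)
    (ContinuousLinearMap.proj (R := ℝ) (φ := fun _ : Fin 6 => ℝ) j) u :=
    fun j => hasFDerivAt_apply (𝕜 := ℝ) j u
  fin_cases i
  · have e0 : (fun w => fluxF w 0) = fun w : St => w 0 * vx w := by
      funext w; simp [fluxF, rho]
    have H := (c 0).fun_mul hx
    change fderiv ℝ (fun w => fluxF w 0) u e = _
    rw [e0, H.fderiv]
    simp [dflux, ex]
    field_simp
    ring
  · have e0 : (fun w => fluxF w 1) = fun w : St => w 3 := by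
      funext w; simp [fluxF, pxx]; ring
    change fderiv ℝ (fun w => fluxF w 1) u e = _
    rw [e0, (c 3).fderiv]
    simp [dflux]
  · have e0 : (fun w => fluxF w 2) = fun w : St => w 4 := by
      funext w; simp [fluxF, pxy]
    change fderiv ℝ (fun w => fluxF w 2) u e = _
    rw [e0, (c 4).fderiv]
    simp [dflux]
  · have e0 : (fun w => fluxF w 3) = fun w : St => 3 * (vx w * w 3) - 2 * (w 0 * vx w * vx w * vx w) := by
      funext w; simp [fluxF, pxx, rho]; ring
    have H := ((hx.fun_mul (c 3)).const_mul 3).fun_sub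
      (((((c 0).fun_mul hx).fun_mul hx).fun_mul hx).const_mul 2)
    change fderiv ℝ (fun w => fluxF w 3) u e = _
    rw [e0, H.fderiv]
    simp [dflux, ex]
    ring
  · have e0 : (fun w => fluxF w 4) = fun w : St =>
        2 * (vx w * w 4) + vy w * w 3 - 2 * (w 0 * vx w * vx w * vy w) := by
      funext w; simp [fluxF, pxx, pxy, rho]; ring
    have H := (((hx.fun_mul (c 4)).const_mul 2).fun_add (hy.fun_mul (c 3))).fun_sub
      (((((c 0).fun_mul hx).fun_mul hx).fun_mul hy).const_mul 2)
    change fderiv ℝ (fun w => fluxF w 4) u e = _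
    rw [e0, H.fderiv]
    simp [dflux, ex, ey]
    ring
  · have e0 : (fun w => fluxF w 5) = fun w : St =>
        vx w * w 5 + 2 * (vy w * w 4) - 2 * (w 0 * vx w * vy w * vy w) := by
      funext w; simp [fluxF, pyy, pxy, rho]; ring
    have H := ((hx.fun_mul (c 5)).fun_add ((hy.fun_mul (c 4)).const_mul 2)).fun_sub
      (((((c 0).fun_mul hx).fun_mul hy).fun_mul hy).const_mul 2)
    change fderiv ℝ (fun w => fluxF w 5) u e = _
    rw [e0, H.fderiv]
    simp [dflux, ex, ey]
    ring

/-- Linear map from primitive to conservative perturbations. -/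
def toCons (r a b : ℝ) (q : St) : St :=
  ![q 0, a * q 0 + r * q 1, b * q 0 + r * q 2,
    a ^ 2 * q 0 + 2 * r * a * q 1 + q 3,
    a * b * q 0 + r * b * q 1 + r * a * q 2 + q 4,
    b ^ 2 * q 0 + 2 * r * b * q 2 + q 5]

/-- The quasi-linear operator in primitive variables. -/
def prim (r a X Y Z : ℝ) (q : St) : St :=
  ![a * q 0 + r * q 1, a * q 1 + q 3 / r, a * q 2 + q 4 / r,
    a * q 3 + 3 * X * q 1, a * q 4 + 2 * Y * q 1 + X * q 2,
    a * q 5 + Z * q 1 + 2 * Y * q 2]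

lemma dflux_toCons (u : St) (h : u 0 ≠ 0) (q : St) :
    dflux u (toCons (u 0) (vx u) (vy u) q) =
      toCons (u 0) (vx u) (vy u) (prim (u 0) (vx u) (pxx u) (pxy u) (pyy u) q) := by
  have h3 : u 3 = pxx u + u 0 * vx u * vx u := by simp [pxx, rho]
  have h4 : u 4 = pxy u + u 0 * vx u * vy u := by simp [pxy, rho]
  have h5 : u 5 = pyy u + u 0 * vy u * vy u := by simp [pyy, rho]
  funext i
  fin_cases i <;> simp [dflux, toCons, prim, h3, h4, h5] <;> field_simp <;> ring

/-- Eigenvectors in primitive variables (`s` is the sound speed, `t` is `√3` times it). -/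
def evec (r X Y Z s t : ℝ) : Fin 6 → St :=
  ![![1, 0, 0, 0, 0, 0], ![0, 0, 0, 0, 0, 1],
    ![0, 0, s, 0, X, 2 * Y], ![0, 0, -s, 0, X, 2 * Y],
    ![r * X, t * X, t * Y, 3 * X * X, 3 * X * Y, Z * X + 2 * Y ^ 2],
    ![r * X, -t * X, -t * Y, 3 * X * X, 3 * X * Y, Z * X + 2 * Y ^ 2]]

/-- Eigenvalues. -/
def eval6 (a s t : ℝ) : St := ![a, a, a + s, a - s, a + t, a - t]

lemma prim_evec (r a X Y Z s t : ℝ) (hr : r ≠ 0) (hs : r * s ^ 2 = X) (ht : r * t ^ 2 = 3 * X)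
    (j : Fin 6) :
    prim r a X Y Z (evec r X Y Z s t j) = eval6 a s t j • evec r X Y Z s t j := by
  funext i
  fin_cases j <;> fin_cases i <;> simp [prim, evec, eval6] <;> (try field_simp) <;> grind

lemma toCons_smul (r a b k : ℝ) (q : St) : toCons r a b (k • q) = k • toCons r a b q := by
  funext i
  fin_cases i <;> simp [toCons] <;> ring

lemma jac_mulVec (u : St) (h : u 0 ≠ 0) (e : St) : (jacF u).mulVec e = dflux u e := by
  funext i
  rw [← fderiv_flux u h e i]
  set L := fderiv ℝ (fun w => fluxF w i) u with hL
  have : e = ∑ j, e j • (Pi.single j (1 : ℝ) : St) := by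
    funext k; simp [Finset.sum_apply, Pi.single_apply]
  conv_rhs => rw [this, map_sum]
  simp only [Matrix.mulVec, dotProduct, map_smul, smul_eq_mul]
  exact Finset.sum_congr rfl fun j _ => mul_comm _ _

lemma indep (r a b X Y Z s t : ℝ) (hr : r ≠ 0) (hX : X ≠ 0) (hs : s ≠ 0) (ht : t ≠ 0)
    (c : St) (hc : ∀ i, ∑ j, c j * toCons r a b (evec r X Y Z s t j) i = 0) : c = 0 := by
  have g0 := hc 0
  have g1 := hc 1
  have g2 := hc 2
  have g3 := hc 3
  have g4 := hc 4
  have g5 := hc 5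
  clear hc
  simp [Fin.sum_univ_six, toCons, evec] at g0 g1 g2 g3 g4 g5
  have k1 : (r * t * X) * (c 4 - c 5) = 0 := by linear_combination g1 - a * g0
  have k1' : c 4 - c 5 = 0 := by
    rcases mul_eq_zero.1 k1 with h | h
    · exact absurd h (by positivity)
    · exact h
  have k2 : (r * s) * (c 2 - c 3) = 0 := by
    linear_combination g2 - b * g0 - r * t * Y * k1'
  have k2' : c 2 - c 3 = 0 := by
    rcases mul_eq_zero.1 k2 with h | h
    · exact absurd h (by positivity)
    · exact h
  have k3 : (3 * X * X) * (c 4 + c 5) = 0 := by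
    linear_combination g3 - a ^ 2 * g0 - 2 * r * a * t * X * k1'
  have k3' : c 4 + c 5 = 0 := by
    rcases mul_eq_zero.1 k3 with h | h
    · exact absurd h (by positivity)
    · exact h
  have c4 : c 4 = 0 := by linarith
  have c5 : c 5 = 0 := by linarith
  simp only [c4, c5] at g0 g4 g5
  have c0 : c 0 = 0 := by linarith
  have k4 : X * (c 2 + c 3) = 0 := by
    linear_combination g4 - a * b * g0 - r * a * s * k2'
  have k4' : c 2 + c 3 = 0 := (mul_eq_zero.1 k4).resolve_left hX
  have c2 : c 2 = 0 := by linarith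
  have c3 : c 3 = 0 := by linarith
  simp only [c0, c2, c3] at g5
  have c1 : c 1 = 0 := by linarith
  funext i
  fin_cases i <;> simp [*]

end TenMoment

open TenMoment in
/-- For every admissible state `u ∈ Ω`, the flux Jacobian `Df(u)` is
diagonalizable over `ℝ` (hyperbolicity of the one-dimensional ten-moment system). -/
theorem tenMoment_jacobian_diagonalizable (u : St) (hu : admissible u) :
    ∃ (P : Matrix (Fin 6) (Fin 6) ℝ) (d : Fin 6 → ℝ),
      IsUnit P.det ∧ jacF u = P * Matrix.diagonal d * P⁻¹ := by
  obtain ⟨hr, hp⟩ := hu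
  have hX : 0 < pxx u := by
    have := hp.diag_pos (i := 0)
    simpa [pmat] using this
  have hr' : 0 < u 0 := hr
  set s := Real.sqrt (pxx u / u 0) with hs
  set t := Real.sqrt (3 * pxx u / u 0) with ht
  have hs0 : 0 < s := Real.sqrt_pos.2 (by positivity)
  have ht0 : 0 < t := Real.sqrt_pos.2 (by positivity)
  have hs2 : u 0 * s ^ 2 = pxx u := by
    rw [hs, Real.sq_sqrt (by positivity)]; field_simp
  have ht2 : u 0 * t ^ 2 = 3 * pxx u := by
    rw [ht, Real.sq_sqrt (by positivity)]; field_simp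
  let E : Fin 6 → St := fun j =>
    toCons (u 0) (vx u) (vy u) (evec (u 0) (pxx u) (pxy u) (pyy u) s t j)
  let P : Matrix (Fin 6) (Fin 6) ℝ := Matrix.of fun i j => E j i
  have hdet : P.det ≠ 0 := by
    intro h0
    obtain ⟨c, hc, hPc⟩ := Matrix.exists_mulVec_eq_zero_iff.2 h0
    refine hc (indep (u 0) (vx u) (vy u) (pxx u) (pxy u) (pyy u) s t hr'.ne' hX.ne' hs0.ne'
      ht0.ne' c fun i => ?_)
    have := congrFun hPc i
    simp only [Matrix.mulVec, dotProduct, Pi.zero_apply] at this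
    rw [← this]
    exact Finset.sum_congr rfl fun j _ => mul_comm _ _
  have hU : IsUnit P.det := isUnit_iff_ne_zero.2 hdet
  refine ⟨P, eval6 (vx u) s t, hU, ?_⟩
  have key : jacF u * P = P * Matrix.diagonal (eval6 (vx u) s t) := by
    ext i j
    rw [Matrix.mul_diagonal]
    have h1 : (jacF u).mulVec (E j) = eval6 (vx u) s t j • E j := by
      rw [jac_mulVec u hr'.ne']
      simp only [E]
      rw [dflux_toCons u hr'.ne', prim_evec _ _ _ _ _ _ _ hr'.ne' hs2 ht2, toCons_smul]
    have h2 := congrFun h1 i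
    rw [Pi.smul_apply, smul_eq_mul, mul_comm] at h2
    exact h2
  rw [← key, Matrix.mul_assoc, Matrix.mul_nonsing_inv _ hU, Matrix.mul_one]
end
end
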